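/- arXiv:2310.09544 — 12 statements merged into one kernel-verified Lean document; each statement's English description precedes it below -/
import Mathlib

section
/- For every p ∈ P̄ ∪ P², the function w : [0,1] → ℝ defined by w(q) = p₁ − c₁ for q < q̄(p) and w(q) = p₂ − c₂ for q ≥ q̄(p) is the quasiconcave envelope of the expert's indirect utility v(·; p): w is quasiconcave on [0,1], w(q) ≥ v(q; p) for every q ∈ [0,1], and every quasiconcave function g : [0,1] → ℝ with g(q) ≥ v(q; p) for all q satisfies g(q) ≥ w(q) for all q. -/
open Set Filter
open scoped Classical

noncomputable section

/-- The cutoff posterior q̄(p). -/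
def qBar (l₁ l₂ p₁ p₂ : ℝ) : ℝ :=
  if l₂ - (l₂ - l₁) / l₁ * p₁ ≤ p₂ then (p₂ - l₁) / (l₂ - l₁) else (p₂ - p₁) / l₂

/-- The slope λ(p). -/
def lamP (c₁ c₂ l₁ l₂ p₁ p₂ : ℝ) : ℝ :=
  ((p₂ - c₂) - (p₁ - c₁)) / qBar l₁ l₂ p₁ p₂

/-- The credibility threshold χ̲(q₀; p). -/
def chiLo (l₁ l₂ p₁ p₂ q₀ : ℝ) : ℝ :=
  (qBar l₁ l₂ p₁ p₂ - q₀) / (qBar l₁ l₂ p₁ p₂ * (1 - q₀))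

/-- The prior threshold q̲(χ; p). -/
def qLo (l₁ l₂ p₁ p₂ χ : ℝ) : ℝ :=
  qBar l₁ l₂ p₁ p₂ * (1 - χ) / (1 - χ * qBar l₁ l₂ p₁ p₂)

/-- p = (p₁, p₂) is a price list. -/
def IsPriceList (c₁ c₂ l₁ l₂ p₁ p₂ : ℝ) : Prop :=
  c₁ ≤ p₁ ∧ p₁ ≤ l₁ ∧ c₂ ≤ p₂ ∧ p₂ ≤ l₂ ∧ p₁ ≤ p₂

/-- The expert's p-equilibrium value v*_χ(q₀; p) for p ∈ P̄ ∪ P². -/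
def vStar (c₁ c₂ l₁ l₂ χ q₀ p₁ p₂ : ℝ) : ℝ :=
  if qBar l₁ l₂ p₁ p₂ < q₀ then p₂ - c₂
  else if qLo l₁ l₂ p₁ p₂ χ ≤ q₀ then lamP c₁ c₂ l₁ l₂ p₁ p₂ * q₀ + (p₁ - c₁)
  else p₁ - c₁

/-- The credibility threshold χ*(q₀). -/
def chiStarF (c₁ c₂ l₁ l₂ q₀ : ℝ) : ℝ :=
  ((c₂ - c₁) - q₀ * (l₂ - l₁)) / ((1 - q₀) * (c₂ - c₁))

end
noncomputable section

/-- The client's expected payoff at posterior `q` from each of the three actions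
`a₀` (no treatment), `a₁` (minor treatment), `a₂` (serious treatment). -/
def uC (l₁ l₂ p₁ p₂ q : ℝ) : Fin 3 → ℝ
  | 0 => -(1 - q) * l₁ - q * l₂
  | 1 => -p₁ - q * l₂
  | 2 => -p₂

/-- The expert's payoff from each of the three actions. -/
def uE (c₁ c₂ p₁ p₂ : ℝ) : Fin 3 → ℝ
  | 0 => 0
  | 1 => p₁ - c₁
  | 2 => p₂ - c₂

/-- The expert's indirect utility v(q; p): the maximum of the expert's payoff over the
client's optimal actions at posterior q (ties broken in the expert's favor). -/
def indirectV (c₁ c₂ l₁ l₂ p₁ p₂ q : ℝ) : ℝ :=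
  sSup {e | ∃ a : Fin 3,
    (∀ a' : Fin 3, uC l₁ l₂ p₁ p₂ q a' ≤ uC l₁ l₂ p₁ p₂ q a) ∧ e = uE c₁ c₂ p₁ p₂ a}

end

/-- Below the cutoff, the serious treatment is strictly worse for the client than one of the
other two actions; from the cutoff on, it is at least as good as both. -/
theorem qBar_le_iff {l₁ l₂ p₁ p₂ : ℝ} (hl₁ : 0 < l₁) (hl : l₁ < l₂) (q : ℝ) :
    qBar l₁ l₂ p₁ p₂ ≤ q ↔ p₂ ≤ (1 - q) * l₁ + q * l₂ ∧ p₂ ≤ p₁ + q * l₂ := by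
  have hd : 0 < l₂ - l₁ := sub_pos.mpr hl
  have hl₂ : 0 < l₂ := hl₁.trans hl
  have hcond : l₂ - (l₂ - l₁) / l₁ * p₁ ≤ p₂ ↔ (l₂ - p₂) * l₁ ≤ (l₂ - l₁) * p₁ := by
    rw [sub_le_comm, div_mul_eq_mul_div, le_div_iff₀ hl₁]
  unfold qBar
  split_ifs with h <;> rw [hcond] at h
  · rw [div_le_iff₀ hd]
    refine ⟨fun hq ↦ ⟨by linarith, ?_⟩, fun hq ↦ by linarith [hq.1]⟩
    have : (l₂ - l₁) * p₂ ≤ (l₂ - l₁) * (p₁ + q * l₂) := by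
      linarith [mul_le_mul_of_nonneg_right hq hl₂.le]
    exact le_of_mul_le_mul_left this hd
  · rw [div_le_iff₀ hl₂]
    refine ⟨fun hq ↦ ⟨?_, by linarith⟩, fun hq ↦ by linarith [hq.2]⟩
    have : l₂ * p₂ ≤ l₂ * ((1 - q) * l₁ + q * l₂) := by
      linarith [mul_le_mul_of_nonneg_right hq hd.le]
    exact le_of_mul_le_mul_left this hl₂

/-- The expert's payoff from a client-optimal action is a lower bound for the indirect utility. -/
theorem uE_le_indirectV (c₁ c₂ : ℝ) {l₁ l₂ p₁ p₂ q : ℝ} {a : Fin 3}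
    (ha : ∀ a', uC l₁ l₂ p₁ p₂ q a' ≤ uC l₁ l₂ p₁ p₂ q a) :
    uE c₁ c₂ p₁ p₂ a ≤ indirectV c₁ c₂ l₁ l₂ p₁ p₂ q := by
  refine le_csSup ((Set.finite_range (uE c₁ c₂ p₁ p₂)).subset ?_).bddAbove ⟨a, ha, rfl⟩
  rintro _ ⟨b, -, rfl⟩
  exact ⟨b, rfl⟩

/-- From the cutoff on, the serious treatment is optimal for the client. -/
theorem sub_le_indirectV_of_qBar_le (c₁ c₂ : ℝ) {l₁ l₂ p₁ p₂ q : ℝ} (hl₁ : 0 < l₁)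
    (hl : l₁ < l₂) (hq : qBar l₁ l₂ p₁ p₂ ≤ q) :
    p₂ - c₂ ≤ indirectV c₁ c₂ l₁ l₂ p₁ p₂ q := by
  obtain ⟨h0, h1⟩ := (qBar_le_iff hl₁ hl q).mp hq
  refine uE_le_indirectV (a := 2) c₁ c₂ fun a' ↦ ?_
  fin_cases a' <;> simp only [uC] <;> linarith

/-- for p ∈ P̄ ∪ P², the step function with value p₁ − c₁ below q̄(p) and
p₂ − c₂ from q̄(p) onwards is the quasiconcave envelope of v(·; p) on [0,1]. -/
theorem quasiconcave_envelope_of_indirect_utility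
    (c₁ c₂ l₁ l₂ : ℝ) (hc₁ : 0 ≤ c₁) (hc : c₁ < c₂) (h₁ : c₁ < l₁) (h₂ : c₂ < l₂)
    (hs : l₁ - c₁ < l₂ - c₂)
    (p₁ p₂ : ℝ) (hp : IsPriceList c₁ c₂ l₁ l₂ p₁ p₂)
    (hmem : p₁ - c₁ ≤ p₂ - c₂)
    (w : ℝ → ℝ)
    (hw : ∀ q, w q = if q < qBar l₁ l₂ p₁ p₂ then p₁ - c₁ else p₂ - c₂) :
    QuasiconcaveOn ℝ (Set.Icc (0:ℝ) 1) w ∧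
    (∀ q ∈ Set.Icc (0:ℝ) 1, indirectV c₁ c₂ l₁ l₂ p₁ p₂ q ≤ w q) ∧
    (∀ g : ℝ → ℝ, QuasiconcaveOn ℝ (Set.Icc (0:ℝ) 1) g →
      (∀ q ∈ Set.Icc (0:ℝ) 1, indirectV c₁ c₂ l₁ l₂ p₁ p₂ q ≤ g q) →
      ∀ q ∈ Set.Icc (0:ℝ) 1, w q ≤ g q) := by
  obtain ⟨hp1, hp1', hp2, hp2', hpp⟩ := hp
  have hl₁ : 0 < l₁ := hc₁.trans_lt h₁
  have hl : l₁ < l₂ := by linarith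
  refine ⟨?_, fun q _ ↦ ?_, fun g hg hvg q hq ↦ ?_⟩
  · have hmono : Monotone w := by
      intro x y hxy
      rw [hw, hw]
      split_ifs <;> linarith
    exact (hmono.monotoneOn _).quasiconcaveOn (convex_Icc 0 1)
  · rw [hw]
    refine Real.sSup_le ?_ (by split_ifs <;> linarith)
    rintro _ ⟨a, ha, rfl⟩
    split_ifs with h
    · have hne := mt (qBar_le_iff hl₁ hl q).mpr h.not_ge
      have h0 := ha 0
      have h1 := ha 1
      fin_cases a <;> simp only [uC, uE] at h0 h1 ⊢
      · linarith
      · exact le_rfl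
      · exact (hne ⟨by linarith, by linarith⟩).elim
    · fin_cases a <;> simp only [uE] <;> linarith
  · rw [hw]
    split_ifs with h
    · have hone : qBar l₁ l₂ p₁ p₂ ≤ 1 :=
        (qBar_le_iff hl₁ hl 1).mpr ⟨by linarith, by linarith⟩
      have h0 : p₁ - c₁ ≤ g 0 := by
        refine le_trans (uE_le_indirectV (a := 1) c₁ c₂ fun a' ↦ ?_) (hvg 0 (by simp))
        fin_cases a' <;> simp only [uC] <;> linarith
      have h1 : p₁ - c₁ ≤ g 1 :=
        (hmem.trans (sub_le_indirectV_of_qBar_le c₁ c₂ hl₁ hl hone)).trans (hvg 1 (by simp))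
      exact ((hg (p₁ - c₁)).ordConnected.out ⟨by simp, h0⟩ ⟨by simp, h1⟩ hq).2
    · exact (sub_le_indirectV_of_qBar_le c₁ c₂ hl₁ hl (not_lt.mp h)).trans (hvg q hq)
end

section
/- (Proposition 1.) Let p ∈ P², q₀ ∈ (0, q̄(p)) and χ ∈ (0,1). If χ ≥ χ̲(q₀; p), then the supremum of the objective value over feasible triples equals λ(p)·q₀ + (p₁ − c₁) and is attained by some feasible triple; if χ < χ̲(q₀; p), then the supremum of the objective value over feasible triples equals p₁ − c₁ and is attained by some feasible triple. -/
open Set Filter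
open scoped Classical

noncomputable section

/-- Feasibility of a triple (β, γ, k) in the Lipnowski–Ravid–Shishkin program. -/
def Feasible (q₀ χ β γ k : ℝ) : Prop :=
  β ∈ Set.Icc (0:ℝ) 1 ∧ γ ∈ Set.Icc (0:ℝ) 1 ∧ k ∈ Set.Icc (0:ℝ) 1 ∧
  (1 - k) * γ + k * β = q₀ ∧ k * β ≤ χ * q₀ ∧ k * (1 - β) ≤ χ * (1 - q₀)

/-- The objective value (1 − k)·Q(γ) + k·C(γ, β) of a triple (β, γ, k). -/
def Obj (c₁ c₂ l₁ l₂ p₁ p₂ β γ k : ℝ) : ℝ :=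
  (1 - k) * (if γ < qBar l₁ l₂ p₁ p₂ then p₁ - c₁ else p₂ - c₂) +
  k * (if γ < qBar l₁ l₂ p₁ p₂ then p₁ - c₁
       else min (lamP c₁ c₂ l₁ l₂ p₁ p₂ * β + (p₁ - c₁)) (p₂ - c₂))

/-- The set of objective values over feasible triples. -/
def ObjValues (c₁ c₂ l₁ l₂ p₁ p₂ q₀ χ : ℝ) : Set ℝ :=
  {e | ∃ β γ k : ℝ, Feasible q₀ χ β γ k ∧ e = Obj c₁ c₂ l₁ l₂ p₁ p₂ β γ k}

end
/-- The cutoff posterior is at most one. -/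
theorem qBar_le_one {l₁ l₂ p₁ p₂ : ℝ} (hl : l₁ < l₂) (hl₂ : 0 < l₂) (hp₁ : 0 ≤ p₁)
    (hp₂ : p₂ ≤ l₂) : qBar l₁ l₂ p₁ p₂ ≤ 1 := by
  unfold qBar
  split_ifs
  · rw [div_le_one (by linarith)]
    linarith
  · rw [div_le_one hl₂]
    linarith

theorem Obj_of_lt {l₁ l₂ p₁ p₂ γ : ℝ} (c₁ c₂ β k : ℝ) (hγ : γ < qBar l₁ l₂ p₁ p₂) :
    Obj c₁ c₂ l₁ l₂ p₁ p₂ β γ k = p₁ - c₁ := by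
  simp only [Obj, if_pos hγ]
  ring

theorem lamP_mul_qBar {l₁ l₂ p₁ p₂ : ℝ} (c₁ c₂ : ℝ) (hq : 0 < qBar l₁ l₂ p₁ p₂) :
    lamP c₁ c₂ l₁ l₂ p₁ p₂ * qBar l₁ l₂ p₁ p₂ = (p₂ - c₂) - (p₁ - c₁) :=
  div_mul_cancel₀ _ hq.ne'

theorem lamP_pos {c₁ c₂ l₁ l₂ p₁ p₂ : ℝ} (hP2 : p₁ - c₁ < p₂ - c₂)
    (hq : 0 < qBar l₁ l₂ p₁ p₂) : 0 < lamP c₁ c₂ l₁ l₂ p₁ p₂ :=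
  div_pos (by linarith) hq

/-- The objective lies below the affine function of the prior with slope `lamP`. -/
theorem Obj_le {c₁ c₂ l₁ l₂ p₁ p₂ q₀ χ β γ k : ℝ} (hP2 : p₁ - c₁ < p₂ - c₂) (hq₀ : 0 < q₀)
    (hq : 0 < qBar l₁ l₂ p₁ p₂) (hf : Feasible q₀ χ β γ k) :
    Obj c₁ c₂ l₁ l₂ p₁ p₂ β γ k ≤ lamP c₁ c₂ l₁ l₂ p₁ p₂ * q₀ + (p₁ - c₁) := by
  have hlam := lamP_pos hP2 hq
  rcases lt_or_ge γ (qBar l₁ l₂ p₁ p₂) with hγ | hγ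
  · rw [Obj_of_lt c₁ c₂ β k hγ]
    linarith [mul_pos hlam hq₀]
  · obtain ⟨-, -, ⟨hk₀, hk₁⟩, hmean, -, -⟩ := hf
    simp only [Obj, if_neg hγ.not_gt]
    have hQ : p₂ - c₂ ≤ lamP c₁ c₂ l₁ l₂ p₁ p₂ * γ + (p₁ - c₁) := by
      linarith [mul_le_mul_of_nonneg_left hγ hlam.le, lamP_mul_qBar c₁ c₂ hq]
    calc _ ≤ (1 - k) * (lamP c₁ c₂ l₁ l₂ p₁ p₂ * γ + (p₁ - c₁)) +
          k * (lamP c₁ c₂ l₁ l₂ p₁ p₂ * β + (p₁ - c₁)) :=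
        add_le_add (mul_le_mul_of_nonneg_left hQ (by linarith))
          (mul_le_mul_of_nonneg_left (min_le_left _ _) hk₀)
      _ = lamP c₁ c₂ l₁ l₂ p₁ p₂ * q₀ + (p₁ - c₁) := by
        rw [← hmean]
        ring

/-- A feasible triple whose official posterior reaches the cutoff needs credibility at least
`chiLo`. -/
theorem Feasible.chiLo_le {l₁ l₂ p₁ p₂ q₀ χ β γ k : ℝ} (hq₀ : q₀ < 1)
    (hq : 0 < qBar l₁ l₂ p₁ p₂) (hq₁ : qBar l₁ l₂ p₁ p₂ ≤ 1) (hf : Feasible q₀ χ β γ k)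
    (hγ : qBar l₁ l₂ p₁ p₂ ≤ γ) : chiLo l₁ l₂ p₁ p₂ q₀ ≤ χ := by
  obtain ⟨⟨hβ₀, -⟩, -, ⟨hk₀, hk₁⟩, hmean, -, hcred⟩ := hf
  rw [chiLo, div_le_iff₀ (mul_pos hq (by linarith))]
  linarith [mul_le_mul_of_nonneg_left hγ (sub_nonneg.2 hk₁),
    mul_le_mul_of_nonneg_left hcred hq.le,
    mul_nonneg (mul_nonneg hk₀ hβ₀) (sub_nonneg.2 hq₁)]

/-- Proposition 1: for p ∈ P², q₀ ∈ (0, q̄(p)) and χ ∈ (0,1), the supremum of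
the objective value over feasible triples is attained and equals λ(p)·q₀ + (p₁ − c₁) when
χ ≥ χ̲(q₀; p), and equals p₁ − c₁ when χ < χ̲(q₀; p). -/
theorem lrs_program_value
    (c₁ c₂ l₁ l₂ : ℝ) (hc₁ : 0 ≤ c₁) (hc : c₁ < c₂) (h₁ : c₁ < l₁) (h₂ : c₂ < l₂)
    (hs : l₁ - c₁ < l₂ - c₂)
    (p₁ p₂ : ℝ) (hp : IsPriceList c₁ c₂ l₁ l₂ p₁ p₂) (hP2 : p₁ - c₁ < p₂ - c₂)
    (q₀ χ : ℝ) (hq₀ : 0 < q₀) (hq₀' : q₀ < qBar l₁ l₂ p₁ p₂)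
    (hχ : χ ∈ Set.Ioo (0:ℝ) 1) :
    (chiLo l₁ l₂ p₁ p₂ q₀ ≤ χ →
      IsGreatest (ObjValues c₁ c₂ l₁ l₂ p₁ p₂ q₀ χ)
        (lamP c₁ c₂ l₁ l₂ p₁ p₂ * q₀ + (p₁ - c₁))) ∧
    (χ < chiLo l₁ l₂ p₁ p₂ q₀ →
      IsGreatest (ObjValues c₁ c₂ l₁ l₂ p₁ p₂ q₀ χ) (p₁ - c₁)) := by
  obtain ⟨hp₁, -, -, hp₂, -⟩ := hp
  have hq : 0 < qBar l₁ l₂ p₁ p₂ := hq₀.trans hq₀'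
  have hq₁ : qBar l₁ l₂ p₁ p₂ ≤ 1 :=
    qBar_le_one (by linarith) (by linarith) (by linarith) hp₂
  have hq₀₁ : q₀ < 1 := hq₀'.trans_le hq₁
  constructor
  · intro h
    refine ⟨⟨0, qBar l₁ l₂ p₁ p₂, 1 - q₀ / qBar l₁ l₂ p₁ p₂, ?_, ?_⟩, ?_⟩
    · refine ⟨by simp, ⟨hq.le, hq₁⟩, ⟨?_, ?_⟩, ?_, ?_, ?_⟩
      · exact sub_nonneg.2 ((div_le_one hq).2 hq₀'.le)
      · linarith [div_pos hq₀ hq]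
      · field_simp
        ring
      · linarith [mul_pos hχ.1 hq₀]
      · have hcred : qBar l₁ l₂ p₁ p₂ - q₀ ≤ χ * (1 - q₀) * qBar l₁ l₂ p₁ p₂ := by
          rw [chiLo, div_le_iff₀ (mul_pos hq (by linarith))] at h
          linarith
        rw [← div_le_iff₀ hq, sub_div, div_self hq.ne'] at hcred
        linarith
    · have hmin : min (lamP c₁ c₂ l₁ l₂ p₁ p₂ * 0 + (p₁ - c₁)) (p₂ - c₂) = p₁ - c₁ := by
        rw [mul_zero, zero_add, min_eq_left hP2.le]
      simp only [Obj, lt_irrefl, if_false, hmin]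
      rw [lamP]
      field_simp
      ring
    · rintro e ⟨β, γ, k, hf, rfl⟩
      exact Obj_le hP2 hq₀ hq hf
  · intro h
    refine ⟨⟨q₀, q₀, 0, ?_, (Obj_of_lt c₁ c₂ q₀ 0 hq₀').symm⟩, ?_⟩
    · refine ⟨⟨hq₀.le, hq₀₁.le⟩, ⟨hq₀.le, hq₀₁.le⟩, by simp, by ring, ?_, ?_⟩
      · linarith [mul_pos hχ.1 hq₀]
      · linarith [mul_pos hχ.1 (sub_pos.2 hq₀₁)]
    · rintro e ⟨β, γ, k, hf, rfl⟩
      have hγ : γ < qBar l₁ l₂ p₁ p₂ :=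
        lt_of_not_ge fun hγ => h.not_ge (hf.chiLo_le hq₀₁ hq hq₁ hγ)
      exact (Obj_of_lt c₁ c₂ β k hγ).le
end

section
/- (Claim 2 in the proof of Proposition 1.) Let p ∈ P², q₀ ∈ (0, q̄(p)) and χ ∈ (0,1). If (β*, γ*, k*) is a feasible triple whose objective value equals the supremum of the objective value over all feasible triples, and this supremum is strictly greater than p₁ − c₁, then γ* = q̄(p). -/
open Set Filter
open scoped Classical

/-- Objective values of feasible triples are at most `p₂ - c₂` on `P²`. -/
theorem obj_le (c₁ c₂ l₁ l₂ p₁ p₂ q₀ χ β γ k : ℝ) (hP2 : p₁ - c₁ < p₂ - c₂)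
    (hfeas : Feasible q₀ χ β γ k) : Obj c₁ c₂ l₁ l₂ p₁ p₂ β γ k ≤ p₂ - c₂ := by
  obtain ⟨-, -, ⟨hk0, hk1⟩, -⟩ := hfeas
  unfold Obj
  split_ifs
  · linarith
  · nlinarith [min_le_right (lamP c₁ c₂ l₁ l₂ p₁ p₂ * β + (p₁ - c₁)) (p₂ - c₂)]

/-- A feasible triple with `γ` above the cutoff can be strictly improved by lowering `γ` to the
cutoff while keeping `k * β` fixed. -/
theorem exists_feasible_obj_lt (c₁ c₂ l₁ l₂ p₁ p₂ q₀ χ β γ k : ℝ)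
    (hP2 : p₁ - c₁ < p₂ - c₂) (hq₀ : 0 < q₀) (hq₀' : q₀ < qBar l₁ l₂ p₁ p₂) (hχ : χ < 1)
    (hfeas : Feasible q₀ χ β γ k) (hγ : qBar l₁ l₂ p₁ p₂ < γ) :
    ∃ β' γ' k', Feasible q₀ χ β' γ' k' ∧
      Obj c₁ c₂ l₁ l₂ p₁ p₂ β γ k < Obj c₁ c₂ l₁ l₂ p₁ p₂ β' γ' k' := by
  obtain ⟨⟨hβ0, hβ1⟩, ⟨hγ0, hγ1⟩, ⟨hk0, hk1⟩, hmean, hc1, hc2⟩ := hfeas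
  unfold Obj lamP
  set q := qBar l₁ l₂ p₁ p₂
  have hq : 0 < q := hq₀.trans hq₀'
  have hk : k < 1 := by
    refine lt_of_le_of_ne hk1 fun h => ?_
    subst h
    nlinarith
  obtain ⟨k', hk'⟩ : ∃ k', k' = 1 - (1 - k) * γ / q := ⟨_, rfl⟩
  have hk'q : (1 - k') * q = (1 - k) * γ := by
    rw [hk']
    field_simp
    ring
  have hb : 0 ≤ k * β := mul_nonneg hk0 hβ0
  have hkk : k' < k := by
    by_contra! h
    nlinarith [mul_pos (sub_pos.2 hk) (sub_pos.2 hγ), mul_nonneg (sub_nonneg.2 h) hq.le]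
  have hbk : k * β < k' := by
    by_contra! h
    nlinarith [mul_nonneg (sub_nonneg.2 h) hq.le,
      mul_nonneg hb (sub_nonneg.2 (hγ.le.trans hγ1))]
  have hk'0 : 0 < k' := hb.trans_lt hbk
  obtain ⟨β', hβ'⟩ : ∃ β', β' = k * β / k' := ⟨_, rfl⟩
  have hkβ : k' * β' = k * β := by
    rw [hβ']
    field_simp
  have hβ'q : β' ≤ q := by
    by_contra! h
    nlinarith [mul_pos hk'0 (sub_pos.2 h)]
  refine ⟨β', q, k', ⟨⟨?_, hβ'q.trans (hγ.le.trans hγ1)⟩, ⟨hq.le, hγ.le.trans hγ1⟩,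
    ⟨hk'0.le, (hkk.trans hk).le⟩, by linarith, by linarith, by linarith⟩, ?_⟩
  · rw [hβ']
    positivity
  rw [if_neg hγ.not_gt, if_neg hγ.not_gt, if_neg (lt_irrefl q), if_neg (lt_irrefl q)]
  obtain ⟨s, hs⟩ : ∃ s, s = (p₂ - c₂ - (p₁ - c₁)) / q := ⟨_, rfl⟩
  have hsq : s * q = p₂ - c₂ - (p₁ - c₁) := by
    rw [hs]
    field_simp
  have hs0 : 0 < s := by
    rw [hs]
    exact div_pos (sub_pos.2 hP2) hq
  rw [← hs, min_eq_left (show s * β' + (p₁ - c₁) ≤ p₂ - c₂ by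
    nlinarith [mul_nonneg hs0.le (sub_nonneg.2 hβ'q)])]
  have hmin := mul_le_mul_of_nonneg_left
    (min_le_left (s * β + (p₁ - c₁)) (p₂ - c₂)) hk0
  have hlin : k' * (s * β') = k * (s * β) := by linear_combination s * hkβ
  nlinarith [mul_pos (sub_pos.2 hkk) (sub_pos.2 hP2)]

/-- Claim 2 in the proof of Proposition 1: any feasible maximizer of the
LRS program with optimal value strictly above p₁ − c₁ has γ* = q̄(p). -/
theorem lrs_maximizer_gamma_eq_qBar
    (c₁ c₂ l₁ l₂ : ℝ) (hc₁ : 0 ≤ c₁) (hc : c₁ < c₂) (h₁ : c₁ < l₁) (h₂ : c₂ < l₂)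
    (hs : l₁ - c₁ < l₂ - c₂)
    (p₁ p₂ : ℝ) (hp : IsPriceList c₁ c₂ l₁ l₂ p₁ p₂) (hP2 : p₁ - c₁ < p₂ - c₂)
    (q₀ χ : ℝ) (hq₀ : 0 < q₀) (hq₀' : q₀ < qBar l₁ l₂ p₁ p₂)
    (hχ : χ ∈ Set.Ioo (0:ℝ) 1)
    (β γ k : ℝ) (hfeas : Feasible q₀ χ β γ k)
    (hopt : Obj c₁ c₂ l₁ l₂ p₁ p₂ β γ k = sSup (ObjValues c₁ c₂ l₁ l₂ p₁ p₂ q₀ χ))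
    (hgt : p₁ - c₁ < sSup (ObjValues c₁ c₂ l₁ l₂ p₁ p₂ q₀ χ)) :
    γ = qBar l₁ l₂ p₁ p₂ := by
  rcases lt_trichotomy γ (qBar l₁ l₂ p₁ p₂) with h | h | h
  · refine absurd hgt (not_lt.2 (hopt ▸ le_of_eq ?_))
    simp only [Obj, if_pos h]
    ring
  · exact h
  · obtain ⟨β', γ', k', hfeas', hlt⟩ :=
      exists_feasible_obj_lt c₁ c₂ l₁ l₂ p₁ p₂ q₀ χ β γ k hP2 hq₀ hq₀' hχ.2 hfeas h
    have hbdd : BddAbove (ObjValues c₁ c₂ l₁ l₂ p₁ p₂ q₀ χ) := by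
      refine ⟨p₂ - c₂, ?_⟩
      rintro _ ⟨β, γ, k, hf, rfl⟩
      exact obj_le c₁ c₂ l₁ l₂ p₁ p₂ q₀ χ β γ k hP2 hf
    exact absurd (hopt ▸ le_csSup hbdd ⟨β', γ', k', hfeas', rfl⟩) hlt.not_ge
end

section
/- (Lemma 1.) For every p ∈ P¹, every χ ∈ (0,1) and every q₀ ∈ (0,1), the expert's p-equilibrium value satisfies v¹_χ(q₀; p) < l₁ − c₁ = v*_χ(q₀; (l₁, l₁ − c₁ + c₂)); that is, any price list with a strictly higher margin on the minor treatment yields the expert a strictly lower value than the equal-margin price list (l₁, l₁ − c₁ + c₂). -/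
open Set Filter
open scoped Classical

noncomputable section

/-- The cutoff posterior q̃(p) for p ∈ P¹. -/
def qTil (l₁ l₂ p₁ p₂ : ℝ) : ℝ :=
  if l₂ - (l₂ - l₁) / l₁ * p₁ ≤ p₂ then (l₁ - p₁) / l₁ else (p₂ - p₁) / l₂

/-- The prior threshold q̂(χ; p) for p ∈ P¹. -/
def qHat (l₁ l₂ p₁ p₂ χ : ℝ) : ℝ :=
  qTil l₁ l₂ p₁ p₂ / (1 - (1 - qTil l₁ l₂ p₁ p₂) * χ)

/-- The slope λ̃(p) for p ∈ P¹. -/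
def lamT (c₁ c₂ l₁ l₂ p₁ p₂ : ℝ) : ℝ :=
  ((p₁ - c₁) - (p₂ - c₂)) / (1 - qTil l₁ l₂ p₁ p₂)

/-- The expert's p-equilibrium value v¹_χ(q₀; p) for p ∈ P¹. -/
def vOne (c₁ c₂ l₁ l₂ χ q₀ p₁ p₂ : ℝ) : ℝ :=
  if q₀ ≤ qTil l₁ l₂ p₁ p₂ then p₁ - c₁
  else if q₀ ≤ qHat l₁ l₂ p₁ p₂ χ then
    lamT c₁ c₂ l₁ l₂ p₁ p₂ * (1 - q₀) + (p₂ - c₂)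
  else p₂ - c₂

end

/-- Lemma 1: for every p ∈ P¹, χ ∈ (0,1) and q₀ ∈ (0,1), the expert's
p-equilibrium value is strictly below l₁ − c₁, which is his value at the equal-margin
price list (l₁, l₁ − c₁ + c₂). -/
theorem lemma_one
    (c₁ c₂ l₁ l₂ : ℝ) (hc₁ : 0 ≤ c₁) (hc : c₁ < c₂) (h₁ : c₁ < l₁) (h₂ : c₂ < l₂)
    (hs : l₁ - c₁ < l₂ - c₂)
    (p₁ p₂ : ℝ) (hp : IsPriceList c₁ c₂ l₁ l₂ p₁ p₂) (hP1 : p₂ - c₂ < p₁ - c₁)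
    (χ q₀ : ℝ) (hχ : χ ∈ Set.Ioo (0:ℝ) 1) (hq₀ : q₀ ∈ Set.Ioo (0:ℝ) 1) :
    vOne c₁ c₂ l₁ l₂ χ q₀ p₁ p₂ < l₁ - c₁ ∧
    l₁ - c₁ = vStar c₁ c₂ l₁ l₂ χ q₀ l₁ (l₁ - c₁ + c₂) := by
  obtain ⟨-, hp₁, -, -, hp₁₂⟩ := hp
  obtain ⟨hq_pos, hq_lt⟩ := hq₀
  constructor
  · unfold vOne
    split_ifs with hq hq'
    · have hne : p₁ ≠ l₁ := by
        rintro rfl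
        have hl : p₁ ≠ 0 := (hc₁.trans_lt h₁).ne'
        have htil : qTil p₁ l₂ p₁ p₂ = 0 := by
          rw [qTil, if_pos (by rw [div_mul_cancel₀ _ hl]; linarith), sub_self, zero_div]
        linarith
      linarith [lt_of_le_of_ne hp₁ hne]
    · have hlam : lamT c₁ c₂ l₁ l₂ p₁ p₂ * (1 - q₀) < (p₁ - c₁) - (p₂ - c₂) := by
        rw [lamT, div_mul_eq_mul_div, div_lt_iff₀ (by linarith)]
        exact mul_lt_mul_of_pos_left (by linarith) (by linarith)
      linarith
    · linarith
  · have hmargin : l₁ - c₁ + c₂ - c₂ = l₁ - c₁ := add_sub_cancel_right _ _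
    simp [vStar, lamP, hmargin]
end

section
/- (Claim in the proof of Proposition 3: low serious-treatment prices are never optimal.) Let p ∈ P² satisfy p₂ < l₂ − ((l₂ − l₁)/l₁)·p₁, and let q₀ ∈ (0,1) and χ ∈ (0,1). Then there exists ε₀ > 0 such that for every ε ∈ (0, ε₀), the pair p' = (p₁ + ε, p₂ + ε) is a price list lying in P², it satisfies q̄(p') = q̄(p) and q̲(χ; p') = q̲(χ; p), and v*_χ(q₀; p') > v*_χ(q₀; p). -/
open Set Filter
open scoped Classical

/-- claim in the proof of Proposition 3: if p ∈ P² has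
p₂ < l₂ − ((l₂ − l₁)/l₁)·p₁, then raising both prices by any sufficiently small ε > 0
keeps the price list in P², leaves q̄ and q̲ unchanged, and strictly raises the expert's
p-equilibrium value. -/
theorem low_serious_price_never_optimal
    (c₁ c₂ l₁ l₂ : ℝ) (hc₁ : 0 ≤ c₁) (hc : c₁ < c₂) (h₁ : c₁ < l₁) (h₂ : c₂ < l₂)
    (hs : l₁ - c₁ < l₂ - c₂)
    (p₁ p₂ : ℝ) (hp : IsPriceList c₁ c₂ l₁ l₂ p₁ p₂) (hP2 : p₁ - c₁ < p₂ - c₂)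
    (hlow : p₂ < l₂ - (l₂ - l₁) / l₁ * p₁)
    (q₀ χ : ℝ) (hq₀ : q₀ ∈ Set.Ioo (0:ℝ) 1) (hχ : χ ∈ Set.Ioo (0:ℝ) 1) :
    ∃ ε₀ > (0:ℝ), ∀ ε ∈ Set.Ioo (0:ℝ) ε₀,
      IsPriceList c₁ c₂ l₁ l₂ (p₁ + ε) (p₂ + ε) ∧
      (p₁ + ε) - c₁ < (p₂ + ε) - c₂ ∧
      qBar l₁ l₂ (p₁ + ε) (p₂ + ε) = qBar l₁ l₂ p₁ p₂ ∧
      qLo l₁ l₂ (p₁ + ε) (p₂ + ε) χ = qLo l₁ l₂ p₁ p₂ χ ∧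
      vStar c₁ c₂ l₁ l₂ χ q₀ p₁ p₂ < vStar c₁ c₂ l₁ l₂ χ q₀ (p₁ + ε) (p₂ + ε) := by
  obtain ⟨hcp₁, hpl₁, hcp₂, -, hle⟩ := hp
  have hl₁ : 0 < l₁ := hc₁.trans_lt h₁
  have hl : 0 < l₂ - l₁ := by linarith
  set k := (l₂ - l₁) / l₁ with hk
  have hk0 : 0 < k := div_pos hl hl₁
  have hkl : k * l₁ = l₂ - l₁ := div_mul_cancel₀ _ hl₁.ne'
  have hlt : p₁ < l₁ := by
    refine lt_of_le_of_ne hpl₁ fun h => ?_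
    rw [h] at hlow hle
    linarith
  refine ⟨min (l₁ - p₁) ((l₂ - k * p₁ - p₂) / (1 + k)),
    lt_min (by linarith) (div_pos (by linarith) (by linarith)), fun ε hε => ?_⟩
  obtain ⟨hε0, hεlt⟩ := hε
  obtain ⟨hε₁, hε₂⟩ := lt_min_iff.mp hεlt
  rw [lt_div_iff₀ (by linarith)] at hε₂
  have hlow' : p₂ + ε < l₂ - k * (p₁ + ε) := by linarith
  have hkp : 0 ≤ k * (p₁ + ε) := mul_nonneg hk0.le (by linarith)
  have hq : qBar l₁ l₂ (p₁ + ε) (p₂ + ε) = qBar l₁ l₂ p₁ p₂ := by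
    unfold qBar
    rw [← hk, if_neg hlow'.not_ge, if_neg hlow.not_ge, add_sub_add_right_eq_sub]
  have hqLo : qLo l₁ l₂ (p₁ + ε) (p₂ + ε) χ = qLo l₁ l₂ p₁ p₂ χ := by
    unfold qLo
    rw [hq]
  have hlam : lamP c₁ c₂ l₁ l₂ (p₁ + ε) (p₂ + ε) = lamP c₁ c₂ l₁ l₂ p₁ p₂ := by
    unfold lamP
    rw [hq]
    ring
  refine ⟨⟨by linarith, by linarith, by linarith, by linarith, by linarith⟩, by linarith,
    hq, hqLo, ?_⟩
  unfold vStar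
  rw [hq, hqLo, hlam]
  split_ifs <;> linarith
end

section
/- (Claim in the proof of Proposition 3: a minor-treatment price below l₁ is never optimal.) Let p ∈ P̄ ∪ P² satisfy p₁ < l₁ and p₂ ≥ l₂ − ((l₂ − l₁)/l₁)·p₁, and let q₀ ∈ (0,1) and χ ∈ (0,1). Then there exists a price list p' ∈ P̄ ∪ P² with v*_χ(q₀; p') > v*_χ(q₀; p). -/
open Set Filter
open scoped Classical

theorem qBar_of_high {l₁ l₂ p₁ q : ℝ} (hl : l₁ < l₂)
    (h : l₂ - (l₂ - l₁) / l₁ * p₁ ≤ l₁ + q * (l₂ - l₁)) :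
    qBar l₁ l₂ p₁ (l₁ + q * (l₂ - l₁)) = q := by
  have : l₂ - l₁ ≠ 0 := (sub_pos.2 hl).ne'
  rw [qBar, if_pos h, add_sub_cancel_left, mul_div_cancel_right₀ _ this]

theorem qBar_at_l1 {l₁ l₂ q : ℝ} (h₀ : 0 < l₁) (hl : l₁ < l₂) (hq : 0 ≤ q) :
    qBar l₁ l₂ l₁ (l₁ + q * (l₂ - l₁)) = q := by
  apply qBar_of_high hl
  rw [div_mul_cancel₀ _ h₀.ne']
  nlinarith [mul_nonneg hq (sub_pos.2 hl).le]

/-- Equal markups yield the common markup. -/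
theorem vStar_of_equal_markup {c₁ c₂ l₁ l₂ χ q₀ p₁ p₂ : ℝ} (h : p₂ - c₂ = p₁ - c₁) :
    vStar c₁ c₂ l₁ l₂ χ q₀ p₁ p₂ = p₁ - c₁ := by
  simp [vStar, lamP, h]

theorem vStar_of_mid {c₁ c₂ l₁ l₂ χ q₀ p₁ p₂ q : ℝ} (hq : qBar l₁ l₂ p₁ p₂ = q)
    (h : q₀ ≤ q) (hlo : q * (1 - χ) / (1 - χ * q) ≤ q₀) :
    vStar c₁ c₂ l₁ l₂ χ q₀ p₁ p₂ =
      (p₁ - c₁) + q₀ / q * ((p₂ - c₂) - (p₁ - c₁)) := by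
  rw [vStar, qLo, lamP, hq, if_neg h.not_gt, if_pos hlo]
  ring

/-- claim in the proof of Proposition 3: for p ∈ P̄ ∪ P² with p₁ < l₁ and
p₂ ≥ l₂ − ((l₂ − l₁)/l₁)·p₁, there is a price list p' ∈ P̄ ∪ P² giving the expert a
strictly higher p-equilibrium value. -/
theorem minor_price_below_l1_never_optimal
    (c₁ c₂ l₁ l₂ : ℝ) (hc₁ : 0 ≤ c₁) (hc : c₁ < c₂) (h₁ : c₁ < l₁) (h₂ : c₂ < l₂)
    (hs : l₁ - c₁ < l₂ - c₂)
    (p₁ p₂ : ℝ) (hp : IsPriceList c₁ c₂ l₁ l₂ p₁ p₂) (hmem : p₁ - c₁ ≤ p₂ - c₂)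
    (hp₁ : p₁ < l₁) (hhigh : l₂ - (l₂ - l₁) / l₁ * p₁ ≤ p₂)
    (q₀ χ : ℝ) (hq₀ : q₀ ∈ Set.Ioo (0:ℝ) 1) (hχ : χ ∈ Set.Ioo (0:ℝ) 1) :
    ∃ p₁' p₂' : ℝ, IsPriceList c₁ c₂ l₁ l₂ p₁' p₂' ∧ p₁' - c₁ ≤ p₂' - c₂ ∧
      vStar c₁ c₂ l₁ l₂ χ q₀ p₁ p₂ < vStar c₁ c₂ l₁ l₂ χ q₀ p₁' p₂' := by
  obtain ⟨hq0, hq1⟩ := hq₀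
  obtain ⟨hχ0, hχ1⟩ := hχ
  obtain ⟨hp1, hp1', hp2, hp2', hp12⟩ := hp
  have hl : l₁ < l₂ := by linarith
  have hl0 : 0 < l₁ := by linarith
  have hL : 0 < l₂ - l₁ := by linarith
  -- A value below `l₁ - c₁` is beaten by the equal-markup list at `p₁ = l₁`.
  by_cases hval : vStar c₁ c₂ l₁ l₂ χ q₀ p₁ p₂ < l₁ - c₁
  · refine ⟨l₁, l₁ - c₁ + c₂, ⟨h₁.le, le_rfl, ?_, ?_, ?_⟩, ?_, ?_⟩
    iterate 4 linarith
    rwa [vStar_of_equal_markup (p₁ := l₁) (by ring)]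
  obtain ⟨q, rfl⟩ : ∃ q, p₂ = l₁ + q * (l₂ - l₁) :=
    ⟨(p₂ - l₁) / (l₂ - l₁), by field_simp; ring⟩
  have hqb := qBar_of_high hl hhigh
  have hqpos : 0 < q := by
    have : (l₂ - l₁) / l₁ * p₁ < l₂ - l₁ := by
      rw [div_mul_eq_mul_div, div_lt_iff₀ hl0]
      exact mul_lt_mul_of_pos_left hp₁ hL
    exact pos_of_mul_pos_left (by linarith : 0 < q * (l₂ - l₁)) hL.le
  rcases lt_or_ge q q₀ with hlt | hge
  · obtain ⟨q', hq', hq'₀⟩ := exists_between hlt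
    have hm : q * (l₂ - l₁) < q' * (l₂ - l₁) := mul_lt_mul_of_pos_right hq' hL
    have hm' : q' * (l₂ - l₁) ≤ 1 * (l₂ - l₁) :=
      mul_le_mul_of_nonneg_right (by linarith) hL.le
    refine ⟨p₁, l₁ + q' * (l₂ - l₁), ⟨hp1, hp1', ?_, ?_, ?_⟩, ?_, ?_⟩
    iterate 4 linarith
    have hqb' := qBar_of_high (q := q') hl (hhigh.trans (by linarith))
    rw [vStar, vStar, hqb, hqb', if_pos hlt, if_pos hq'₀]
    linarith
  have hlo : q * (1 - χ) / (1 - χ * q) ≤ q₀ := by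
    by_contra hlo
    apply hval
    rw [vStar, qLo, hqb, if_neg hge.not_gt, if_neg hlo]
    linarith
  have hv := vStar_of_mid (c₁ := c₁) (c₂ := c₂) hqb hge hlo
  rw [hv] at hval ⊢
  have hr0 : 0 < q₀ / q := div_pos hq0 hqpos
  have hr1 : q₀ / q ≤ 1 := (div_le_one hqpos).2 hge
  have hd : l₁ - c₁ ≤ l₁ + q * (l₂ - l₁) - c₂ := by
    by_contra hd
    exact hval (by nlinarith)
  rcases hge.lt_or_eq with hgt | rfl
  · refine ⟨l₁, l₁ + q * (l₂ - l₁), ⟨h₁.le, le_rfl, hp2, hp2', ?_⟩, hd, ?_⟩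
    · linarith
    rw [vStar_of_mid (qBar_at_l1 hl0 hl hqpos.le) hge hlo]
    have hr1' : q₀ / q < 1 := (div_lt_one hqpos).2 hgt
    nlinarith
  -- When the prior equals the cutoff, raise the cutoff until the lower threshold meets the prior.
  · have hD : 0 < 1 - χ + χ * q₀ := by nlinarith
    have hDχ : χ * q₀ < χ := by nlinarith
    obtain ⟨q', hq'def⟩ : ∃ q', q' = q₀ / (1 - χ + χ * q₀) := ⟨_, rfl⟩
    have hmul : q' * (1 - χ + χ * q₀) = q₀ := by
      rw [hq'def, div_mul_cancel₀ _ hD.ne']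
    have hq' : q₀ < q' := by
      rw [hq'def, lt_div_iff₀ hD]
      nlinarith
    have hq'1 : q' < 1 := by
      rw [hq'def, div_lt_one hD]
      nlinarith
    have hlo' : q' * (1 - χ) / (1 - χ * q') ≤ q₀ := by
      rw [div_le_iff₀ (by nlinarith)]
      linarith
    have hq'pos : 0 < q' := hq0.trans hq'
    have hm : q₀ * (l₂ - l₁) < q' * (l₂ - l₁) := mul_lt_mul_of_pos_right hq' hL
    have hm' : q' * (l₂ - l₁) < 1 * (l₂ - l₁) := mul_lt_mul_of_pos_right hq'1 hL
    refine ⟨l₁, l₁ + q' * (l₂ - l₁), ⟨h₁.le, le_rfl, ?_, ?_, ?_⟩, ?_, ?_⟩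
    · linarith
    · linarith
    · exact le_add_of_nonneg_right (mul_pos hq'pos hL).le
    · linarith
    rw [vStar_of_mid (qBar_at_l1 hl0 hl hq'pos.le) hq'.le hlo', div_self hq0.ne']
    have hr' : q₀ / q' < 1 := (div_lt_one hq'pos).2 hq'
    have hrq : q₀ / q' * q' = q₀ := div_mul_cancel₀ _ hq'pos.ne'
    have hexp : q₀ / q' * (l₁ + q' * (l₂ - l₁) - c₂ - (l₁ - c₁)) =
        q₀ * (l₂ - l₁) - q₀ / q' * (c₂ - c₁) := by
      linear_combination (l₂ - l₁) * hrq
    rw [hexp]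
    nlinarith
end

section
/- (Claim in the proof of Proposition 3: the unique optimal serious-treatment price given p₁ = l₁.) Suppose q₀ ∈ (0,1), χ ∈ (0,1) and χ > max(χ*(q₀), 0). Set p₂* = l₁ + q₀·(l₂ − l₁)/(1 − χ + χ·q₀). Then p₂* ∈ (l₁ − c₁ + c₂, l₂], χ̲(q₀; (l₁, p₂*)) = χ, and v*_χ(q₀; (l₁, p₂)) < v*_χ(q₀; (l₁, p₂*)) for every p₂ ∈ [l₁ − c₁ + c₂, l₂] with p₂ ≠ p₂*. -/
open Set Filter
open scoped Classical

/-- At `p₁ = l₁`, the price `p₂ = l₁ + q (l₂ - l₁)` with `q ≥ 0` has cutoff posterior `q`. -/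
lemma qBar_lineMap {l₁ l₂ q : ℝ} (hl₁ : 0 < l₁) (hl : l₁ < l₂) (hq : 0 ≤ q) :
    qBar l₁ l₂ l₁ (l₁ + q * (l₂ - l₁)) = q := by
  have hL : 0 < l₂ - l₁ := sub_pos.2 hl
  have hle : l₂ - (l₂ - l₁) / l₁ * l₁ ≤ l₁ + q * (l₂ - l₁) := by
    rw [div_mul_cancel₀ _ hl₁.ne']
    linarith [mul_nonneg hq hL.le]
  rw [qBar, if_pos hle, add_sub_cancel_left, mul_div_cancel_right₀ _ hL.ne']

/-- The expert's equilibrium value at `p₁ = l₁`, in terms of the cutoff posterior `q`. -/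
lemma vStar_lineMap {c₁ c₂ l₁ l₂ χ q₀ q : ℝ} (hl₁ : 0 < l₁) (hl : l₁ < l₂) (hq : 0 < q)
    (hχq : χ * q < 1) :
    vStar c₁ c₂ l₁ l₂ χ q₀ l₁ (l₁ + q * (l₂ - l₁)) =
      if q < q₀ then l₁ + q * (l₂ - l₁) - c₂
      else if q * (1 - χ + χ * q₀) ≤ q₀ then
        (l₂ - l₁) * q₀ - (c₂ - c₁) * (q₀ / q) + (l₁ - c₁)
      else l₁ - c₁ := by
  have hiff : q * (1 - χ) / (1 - χ * q) ≤ q₀ ↔ q * (1 - χ + χ * q₀) ≤ q₀ := by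
    rw [div_le_iff₀ (by linarith)]
    constructor <;> intro h <;> linarith
  have hval : (l₁ + q * (l₂ - l₁) - c₂ - (l₁ - c₁)) / q * q₀ =
      (l₂ - l₁) * q₀ - (c₂ - c₁) * (q₀ / q) := by
    field_simp
    ring
  simp only [vStar, qLo, lamP, qBar_lineMap hl₁ hl hq.le, hiff, hval]

/-- claim in the proof of Proposition 3: given p₁ = l₁ and
χ > max(χ*(q₀), 0), the price p₂* = l₁ + q₀(l₂ − l₁)/(1 − χ + χq₀) lies in
(l₁ − c₁ + c₂, l₂], satisfies χ̲(q₀; (l₁, p₂*)) = χ, and is the unique maximizer of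
p₂ ↦ v*_χ(q₀; (l₁, p₂)) on [l₁ − c₁ + c₂, l₂]. -/
theorem unique_optimal_serious_price
    (c₁ c₂ l₁ l₂ : ℝ) (hc₁ : 0 ≤ c₁) (hc : c₁ < c₂) (h₁ : c₁ < l₁) (h₂ : c₂ < l₂)
    (hs : l₁ - c₁ < l₂ - c₂)
    (q₀ χ : ℝ) (hq₀ : q₀ ∈ Set.Ioo (0:ℝ) 1) (hχ : χ ∈ Set.Ioo (0:ℝ) 1)
    (hχ' : max (chiStarF c₁ c₂ l₁ l₂ q₀) 0 < χ) :
    l₁ - c₁ + c₂ < l₁ + q₀ * (l₂ - l₁) / (1 - χ + χ * q₀) ∧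
    l₁ + q₀ * (l₂ - l₁) / (1 - χ + χ * q₀) ≤ l₂ ∧
    chiLo l₁ l₂ l₁ (l₁ + q₀ * (l₂ - l₁) / (1 - χ + χ * q₀)) q₀ = χ ∧
    ∀ p₂ ∈ Set.Icc (l₁ - c₁ + c₂) l₂, p₂ ≠ l₁ + q₀ * (l₂ - l₁) / (1 - χ + χ * q₀) →
      vStar c₁ c₂ l₁ l₂ χ q₀ l₁ p₂ <
        vStar c₁ c₂ l₁ l₂ χ q₀ l₁ (l₁ + q₀ * (l₂ - l₁) / (1 - χ + χ * q₀)) := by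
  obtain ⟨hq₀, hq₀'⟩ := hq₀
  obtain ⟨hχ₀, hχ₁⟩ := hχ
  have hD : 0 < c₂ - c₁ := sub_pos.2 hc
  have hl₁ : 0 < l₁ := hc₁.trans_lt h₁
  have hl : l₁ < l₂ := by linarith
  have hL : 0 < l₂ - l₁ := sub_pos.2 hl
  have hstar : c₂ - c₁ - q₀ * (l₂ - l₁) < χ * ((1 - q₀) * (c₂ - c₁)) :=
    (div_lt_iff₀ (mul_pos (sub_pos.2 hq₀') hD)).1 ((le_max_left _ _).trans_lt hχ')
  have hχq₀ : 0 < χ * q₀ := mul_pos hχ₀ hq₀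
  have hr : 0 < 1 - χ + χ * q₀ := by linarith
  have hr₁ : 1 - χ + χ * q₀ < 1 := by linarith [mul_lt_of_lt_one_right hχ₀ hq₀']
  have hq₀r : q₀ < 1 - χ + χ * q₀ := by
    linarith [mul_pos (sub_pos.2 hχ₁) (sub_pos.2 hq₀')]
  rw [mul_div_right_comm]
  obtain ⟨Q, hQ⟩ : ∃ Q, Q = q₀ / (1 - χ + χ * q₀) := ⟨_, rfl⟩
  rw [← hQ]
  have hQr : Q * (1 - χ + χ * q₀) = q₀ := by rw [hQ, div_mul_cancel₀ _ hr.ne']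
  have hQ₀ : 0 < Q := hQ ▸ div_pos hq₀ hr
  have hQ₁ : Q < 1 := hQ ▸ (div_lt_one hr).2 hq₀r
  have hQq₀ : q₀ < Q := hQr ▸ mul_lt_of_lt_one_right hQ₀ hr₁
  have hDQ : c₂ - c₁ < Q * (l₂ - l₁) := by
    rw [hQ, div_mul_eq_mul_div, lt_div_iff₀ hr]
    linarith
  have hqQ : q₀ / Q = 1 - χ + χ * q₀ := by
    rw [div_eq_iff hQ₀.ne', mul_comm, hQr]
  have hVQ : vStar c₁ c₂ l₁ l₂ χ q₀ l₁ (l₁ + Q * (l₂ - l₁)) =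
      (l₂ - l₁) * q₀ - (c₂ - c₁) * (1 - χ + χ * q₀) + (l₁ - c₁) := by
    rw [vStar_lineMap hl₁ hl hQ₀ (mul_lt_one_of_nonneg_of_lt_one_left hχ₀.le hχ₁ hQ₁.le),
      if_neg hQq₀.not_gt, if_pos hQr.le, hqQ]
  refine ⟨by linarith, by linarith [mul_lt_of_lt_one_left hL hQ₁], ?_, ?_⟩
  · rw [chiLo, qBar_lineMap hl₁ hl hQ₀.le, div_eq_iff (mul_pos hQ₀ (sub_pos.2 hq₀')).ne']
    linarith
  rintro p₂ ⟨hp, hp'⟩ hne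
  obtain ⟨q, rfl⟩ : ∃ q, p₂ = l₁ + q * (l₂ - l₁) :=
    ⟨(p₂ - l₁) / (l₂ - l₁), by rw [div_mul_cancel₀ _ hL.ne']; ring⟩
  have hq : 0 < q := pos_of_mul_pos_left (by linarith : 0 < q * (l₂ - l₁)) hL.le
  have hq₁ : q ≤ 1 := le_of_mul_le_mul_right (by linarith) hL
  have hqne : q ≠ Q := fun h => hne (h ▸ rfl)
  rw [hVQ, vStar_lineMap hl₁ hl hq (mul_lt_one_of_nonneg_of_lt_one_left hχ₀.le hχ₁ hq₁)]
  split_ifs with hlt hle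
  · linarith [mul_lt_mul_of_pos_right hlt hL, mul_lt_mul_of_pos_left hr₁ hD]
  · have hqQ' : q < Q := lt_of_le_of_ne (le_of_mul_le_mul_right (hle.trans hQr.ge) hr) hqne
    have hdiv : q₀ / Q < q₀ / q := div_lt_div_of_pos_left hq₀ hq hqQ'
    rw [hqQ] at hdiv
    linarith [mul_lt_mul_of_pos_left hdiv hD]
  · linarith
end

section
/- (Corollary 2.) (i) For every fixed q₀ ∈ (0, (c₂ − c₁)/(l₂ − l₁)), the map χ ↦ ev*_χ(q₀) is constant on [0, χ*(q₀)] and strictly increasing on [χ*(q₀), 1]. (ii) For every fixed q₀ ∈ [(c₂ − c₁)/(l₂ − l₁), 1), the map χ ↦ ev*_χ(q₀) is strictly increasing on [0, 1]. -/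
open Set Filter
open scoped Classical

open Classical in
/-- The expert's equilibrium value ev*_χ(q₀). -/
noncomputable def evF (c₁ c₂ l₁ l₂ χ q₀ : ℝ) : ℝ :=
  if q₀ ≤ (c₂ - c₁) / (l₂ - l₁) ∧ χ ≤ chiStarF c₁ c₂ l₁ l₂ q₀ then l₁ - c₁
  else ((l₂ - l₁) - χ * (c₂ - c₁)) * q₀ + (l₁ - c₁) - (1 - χ) * (c₂ - c₁)
/-- Above the credibility threshold the equilibrium value is affine in the credibility. -/
theorem evF_eq_of_chiStarF_le {c₁ c₂ l₁ l₂ χ q₀ : ℝ} (hc : c₁ < c₂) (hq : q₀ < 1)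
    (hχ : chiStarF c₁ c₂ l₁ l₂ q₀ ≤ χ) :
    evF c₁ c₂ l₁ l₂ χ q₀ =
      (l₁ - c₁) + (1 - q₀) * (c₂ - c₁) * (χ - chiStarF c₁ c₂ l₁ l₂ q₀) := by
  have hpos : 0 < (1 - q₀) * (c₂ - c₁) := mul_pos (sub_pos.2 hq) (sub_pos.2 hc)
  have hstar : (1 - q₀) * (c₂ - c₁) * chiStarF c₁ c₂ l₁ l₂ q₀ =
      (c₂ - c₁) - q₀ * (l₂ - l₁) := mul_div_cancel₀ _ hpos.ne'
  unfold evF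
  split_ifs with h
  · rw [le_antisymm h.2 hχ]
    ring
  · linear_combination hstar

theorem strictMonoOn_evF {c₁ c₂ l₁ l₂ q₀ : ℝ} (hc : c₁ < c₂) (hq : q₀ < 1) :
    StrictMonoOn (fun χ => evF c₁ c₂ l₁ l₂ χ q₀) (Set.Ici (chiStarF c₁ c₂ l₁ l₂ q₀)) := by
  intro x hx y hy hxy
  have hpos : 0 < (1 - q₀) * (c₂ - c₁) := mul_pos (sub_pos.2 hq) (sub_pos.2 hc)
  simp only [evF_eq_of_chiStarF_le hc hq hx, evF_eq_of_chiStarF_le hc hq hy]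
  gcongr

/-- Corollary 2: (i) for q₀ ∈ (0, (c₂ − c₁)/(l₂ − l₁)), the expert's
equilibrium value is constant in χ on [0, χ*(q₀)] and strictly increasing on [χ*(q₀), 1];
(ii) for q₀ ∈ [(c₂ − c₁)/(l₂ − l₁), 1), it is strictly increasing in χ on [0, 1]. -/
theorem corollary_two
    (c₁ c₂ l₁ l₂ : ℝ) (hc₁ : 0 ≤ c₁) (hc : c₁ < c₂) (h₁ : c₁ < l₁) (h₂ : c₂ < l₂)
    (hs : l₁ - c₁ < l₂ - c₂) :
    (∀ q₀ ∈ Set.Ioo (0:ℝ) ((c₂ - c₁) / (l₂ - l₁)),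
      (∀ χ ∈ Set.Icc (0:ℝ) (chiStarF c₁ c₂ l₁ l₂ q₀),
        ∀ χ' ∈ Set.Icc (0:ℝ) (chiStarF c₁ c₂ l₁ l₂ q₀),
          evF c₁ c₂ l₁ l₂ χ q₀ = evF c₁ c₂ l₁ l₂ χ' q₀) ∧
      StrictMonoOn (fun χ => evF c₁ c₂ l₁ l₂ χ q₀)
        (Set.Icc (chiStarF c₁ c₂ l₁ l₂ q₀) 1)) ∧
    (∀ q₀ ∈ Set.Ico ((c₂ - c₁) / (l₂ - l₁)) (1:ℝ),
      StrictMonoOn (fun χ => evF c₁ c₂ l₁ l₂ χ q₀) (Set.Icc (0:ℝ) 1)) := by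
  have hcl : c₂ - c₁ < l₂ - l₁ := by linarith
  have hl : 0 < l₂ - l₁ := by linarith
  refine ⟨fun q₀ hq => ⟨fun χ hχ χ' hχ' => ?_, ?_⟩, fun q₀ hq => ?_⟩
  · simp only [evF, hq.2.le, hχ.2, hχ'.2, and_self, if_true]
  · have hq1 : q₀ < 1 := hq.2.trans ((div_lt_one hl).2 hcl)
    exact (strictMonoOn_evF hc hq1).mono Set.Icc_subset_Ici_self
  · have hstar : chiStarF c₁ c₂ l₁ l₂ q₀ ≤ 0 :=
      div_nonpos_of_nonpos_of_nonneg (sub_nonpos.2 ((div_le_iff₀ hl).1 hq.1))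
        (mul_nonneg (sub_nonneg.2 hq.2.le) (sub_nonneg.2 hc.le))
    exact (strictMonoOn_evF hc hq.2).mono fun χ hχ => hstar.trans hχ.1
end

section
/- (Continuity and limiting benchmarks of the expert's equilibrium value.) For every fixed q₀ ∈ (0,1), the map χ ↦ ev*_χ(q₀) is continuous on [0,1]; moreover ev*_1(q₀) = q₀·(l₂ − c₂) + (1 − q₀)·(l₁ − c₁) (the full-credibility persuasion benchmark), and ev*_0(q₀) = l₁ − c₁ if q₀ ≤ (c₂ − c₁)/(l₂ − l₁) and ev*_0(q₀) = q₀·(l₂ − l₁) + l₁ − c₂ if q₀ > (c₂ − c₁)/(l₂ − l₁) (the no-credibility cheap-talk benchmark). -/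
open Set Filter
open scoped Classical

/-- For nonnegative credibility, the equilibrium value is the benchmark `l₁ - c₁` plus a multiple of
the excess of the credibility over the threshold. -/
theorem evF_eq_add_max {c₁ c₂ l₁ l₂ χ q₀ : ℝ} (hc : c₁ < c₂) (hl : l₁ < l₂) (hq : q₀ < 1)
    (hχ : 0 ≤ χ) :
    evF c₁ c₂ l₁ l₂ χ q₀ =
      (l₁ - c₁) + (1 - q₀) * (c₂ - c₁) * max 0 (χ - chiStarF c₁ c₂ l₁ l₂ q₀) := by
  have hpos : 0 < (1 - q₀) * (c₂ - c₁) := mul_pos (sub_pos.2 hq) (sub_pos.2 hc)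
  have hmul : (1 - q₀) * (c₂ - c₁) * chiStarF c₁ c₂ l₁ l₂ q₀ =
      (c₂ - c₁) - q₀ * (l₂ - l₁) := mul_div_cancel₀ _ hpos.ne'
  unfold evF
  split_ifs with h
  · rw [max_eq_left (sub_nonpos.2 h.2), mul_zero, add_zero]
  · have hle : chiStarF c₁ c₂ l₁ l₂ q₀ ≤ χ := by
      by_contra! hlt
      refine h ⟨?_, hlt.le⟩
      rw [le_div_iff₀ (sub_pos.2 hl)]
      linarith [mul_pos hpos (hχ.trans_lt hlt)]
    rw [max_eq_right (sub_nonneg.2 hle)]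
    linear_combination hmul

/-- for fixed q₀ ∈ (0,1), χ ↦ ev*_χ(q₀) is continuous on [0,1];
ev*_1(q₀) is the full-credibility persuasion benchmark and ev*_0(q₀) is the
no-credibility cheap-talk benchmark. -/
theorem ev_continuous_and_limits
    (c₁ c₂ l₁ l₂ : ℝ) (hc₁ : 0 ≤ c₁) (hc : c₁ < c₂) (h₁ : c₁ < l₁) (h₂ : c₂ < l₂)
    (hs : l₁ - c₁ < l₂ - c₂)
    (q₀ : ℝ) (hq₀ : q₀ ∈ Set.Ioo (0:ℝ) 1) :
    ContinuousOn (fun χ => evF c₁ c₂ l₁ l₂ χ q₀) (Set.Icc (0:ℝ) 1) ∧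
    evF c₁ c₂ l₁ l₂ 1 q₀ = q₀ * (l₂ - c₂) + (1 - q₀) * (l₁ - c₁) ∧
    (q₀ ≤ (c₂ - c₁) / (l₂ - l₁) → evF c₁ c₂ l₁ l₂ 0 q₀ = l₁ - c₁) ∧
    ((c₂ - c₁) / (l₂ - l₁) < q₀ →
      evF c₁ c₂ l₁ l₂ 0 q₀ = q₀ * (l₂ - l₁) + l₁ - c₂) := by
  obtain ⟨hq0, hq1⟩ := hq₀
  have hl : l₁ < l₂ := by linarith
  have hpos : 0 < (1 - q₀) * (c₂ - c₁) := mul_pos (sub_pos.2 hq1) (sub_pos.2 hc)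
  refine ⟨?_, ?_, fun h => ?_, fun h => ?_⟩
  · refine ContinuousOn.congr (Continuous.continuousOn ?_)
      fun χ hχ => evF_eq_add_max hc hl hq1 hχ.1
    fun_prop
  · have hlt : chiStarF c₁ c₂ l₁ l₂ q₀ < 1 := by
      rw [chiStarF, div_lt_one hpos]
      nlinarith
    rw [evF, if_neg fun h => hlt.not_ge h.2]
    ring
  · refine if_pos ⟨h, div_nonneg ?_ hpos.le⟩
    linarith [(le_div_iff₀ (sub_pos.2 hl)).1 h]
  · rw [evF, if_neg fun h' => h.not_ge h'.1]
    ring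
end

section
/- (Key claim underlying Proposition 4.) Let q₀ ∈ (0, (c₂ − c₁)/(l₂ − l₁)]. Define U(q₂) = (q₀/q₂)·(q₂·l₂ + (1 − q₂)·l₁ − (l₁ − c₁ + c₂)) for q₂ ∈ [(c₂ − c₁)/(l₂ − l₁), 1]. Then U(q₂) = q₀·(l₂ − l₁) − (q₀/q₂)·(c₂ − c₁) for all such q₂; U is continuous and strictly increasing on [(c₂ − c₁)/(l₂ − l₁), 1]; U((c₂ − c₁)/(l₂ − l₁)) = 0; U(1) = q₀·((l₂ − c₂) − (l₁ − c₁)); and the range of U is exactly the interval [0, q₀·((l₂ − c₂) − (l₁ − c₁))]. -/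
/-- key claim underlying Proposition 4: for q₀ ∈ (0, (c₂ − c₁)/(l₂ − l₁)],
the client's surplus function U(q₂) = (q₀/q₂)(q₂l₂ + (1 − q₂)l₁ − (l₁ − c₁ + c₂)) on
[(c₂ − c₁)/(l₂ − l₁), 1] simplifies to q₀(l₂ − l₁) − (q₀/q₂)(c₂ − c₁), is continuous and
strictly increasing, vanishes at the left endpoint, equals q₀((l₂ − c₂) − (l₁ − c₁)) at 1,
and has range exactly [0, q₀((l₂ − c₂) − (l₁ − c₁))]. -/
theorem client_value_range
    (c₁ c₂ l₁ l₂ : ℝ) (hc₁ : 0 ≤ c₁) (hc : c₁ < c₂) (h₁ : c₁ < l₁) (h₂ : c₂ < l₂)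
    (hs : l₁ - c₁ < l₂ - c₂)
    (q₀ : ℝ) (hq₀ : 0 < q₀) (hq₀' : q₀ ≤ (c₂ - c₁) / (l₂ - l₁))
    (U : ℝ → ℝ)
    (hU : ∀ q₂, U q₂ = q₀ / q₂ * (q₂ * l₂ + (1 - q₂) * l₁ - (l₁ - c₁ + c₂))) :
    (∀ q₂ ∈ Set.Icc ((c₂ - c₁) / (l₂ - l₁)) 1,
      U q₂ = q₀ * (l₂ - l₁) - q₀ / q₂ * (c₂ - c₁)) ∧
    ContinuousOn U (Set.Icc ((c₂ - c₁) / (l₂ - l₁)) 1) ∧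
    StrictMonoOn U (Set.Icc ((c₂ - c₁) / (l₂ - l₁)) 1) ∧
    U ((c₂ - c₁) / (l₂ - l₁)) = 0 ∧
    U 1 = q₀ * ((l₂ - c₂) - (l₁ - c₁)) ∧
    U '' Set.Icc ((c₂ - c₁) / (l₂ - l₁)) 1
      = Set.Icc 0 (q₀ * ((l₂ - c₂) - (l₁ - c₁))) := by
  have hd : 0 < l₂ - l₁ := by linarith
  have hn : 0 < c₂ - c₁ := by linarith
  have ha : 0 < (c₂ - c₁) / (l₂ - l₁) := div_pos hn hd
  have ha1 : (c₂ - c₁) / (l₂ - l₁) ≤ 1 := (div_le_one hd).2 (by linarith)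
  have hform : ∀ q₂ ∈ Set.Icc ((c₂ - c₁) / (l₂ - l₁)) 1,
      U q₂ = q₀ * (l₂ - l₁) - q₀ / q₂ * (c₂ - c₁) := by
    intro q hq
    have hq0 : q ≠ 0 := (ha.trans_le hq.1).ne'
    rw [hU]
    field_simp
    ring
  have hcont : ContinuousOn U (Set.Icc ((c₂ - c₁) / (l₂ - l₁)) 1) := by
    refine ContinuousOn.congr ?_ hform
    refine continuousOn_const.sub (ContinuousOn.mul ?_ continuousOn_const)
    exact continuousOn_const.div continuousOn_id fun q hq => (ha.trans_le hq.1).ne'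
  have hmono : StrictMonoOn U (Set.Icc ((c₂ - c₁) / (l₂ - l₁)) 1) := by
    intro x hx y hy hxy
    rw [hform x hx, hform y hy]
    have hlt : q₀ / y < q₀ / x := div_lt_div_of_pos_left hq₀ (ha.trans_le hx.1) hxy
    linarith [mul_lt_mul_of_pos_right hlt hn]
  have hleft : U ((c₂ - c₁) / (l₂ - l₁)) = 0 := by
    rw [hform _ ⟨le_rfl, ha1⟩]
    field_simp
    ring
  have hright : U 1 = q₀ * ((l₂ - c₂) - (l₁ - c₁)) := by
    rw [hU]
    ring
  refine ⟨hform, hcont, hmono, hleft, hright, ?_⟩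
  rw [← hright, ← hleft]
  refine Set.Subset.antisymm ?_ (intermediate_value_Icc ha1 hcont)
  rintro _ ⟨x, hx, rfl⟩
  exact ⟨hmono.monotoneOn ⟨le_rfl, ha1⟩ hx hx.1, hmono.monotoneOn hx ⟨ha1, le_rfl⟩ hx.2⟩
end

section
/- (Claim in the public-credibility analysis: the optimal serious-treatment price is l₂ or the monopoly price.) Let q₀, χ ∈ (0,1) and write p₂^M = q₀·l₂ + (1 − q₀)·l₁. For every p₂ ∈ [l₁ − c₁ + c₂, l₂]: if p₂ > p₂^M and p₂ ≠ l₂, then v^pc_χ(q₀; p₂) < v^pc_χ(q₀; l₂); and if p₂ < p₂^M, then p₂^M ∈ (l₁ − c₁ + c₂, l₂] and v^pc_χ(q₀; p₂) < v^pc_χ(q₀; p₂^M). Consequently, the supremum of v^pc_χ(q₀; ·) over [l₁ − c₁ + c₂, l₂] equals max over the (at most two) points l₂ and p₂^M (the latter when it lies in the interval). -/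
open scoped Classical

noncomputable section

/-- The expert's p-equilibrium value with public credibility at the price list (l₁, p₂). -/
def vPC (c₁ c₂ l₁ l₂ χ q₀ p₂ : ℝ) : ℝ :=
  if q₀ < (p₂ - l₁) / (l₂ - l₁) then
    χ * q₀ * l₂ + (1 - χ * q₀) * l₁ - c₁ - χ * q₀ * (l₂ - l₁) * (c₂ - c₁) / (p₂ - l₁)
  else p₂ - c₂

/-- The prior cutoff q^pc_χ under public credibility. -/
def qPC (c₁ c₂ l₁ l₂ χ : ℝ) : ℝ :=
  (c₂ - c₁) / ((1 - χ) * (l₂ - l₁) + χ * (c₂ - c₁))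

/-- The expert's equilibrium value ev^pc_χ(q₀) under public credibility. -/
def evPC (c₁ c₂ l₁ l₂ χ q₀ : ℝ) : ℝ :=
  if qPC c₁ c₂ l₁ l₂ χ ≤ q₀ then q₀ * l₂ + (1 - q₀) * l₁ - c₂
  else χ * q₀ * (l₂ - c₂) + (1 - χ * q₀) * (l₁ - c₁)

end
/-- The credibility cutoff at price `p` exceeds `q₀` exactly when `p` exceeds the monopoly price. -/
lemma lt_cutoff_iff {l₁ l₂ : ℝ} (hl : l₁ < l₂) (q₀ p : ℝ) :
    q₀ < (p - l₁) / (l₂ - l₁) ↔ q₀ * l₂ + (1 - q₀) * l₁ < p := by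
  rw [lt_div_iff₀ (sub_pos.2 hl)]
  constructor <;> intro h <;> linarith

lemma vPC_of_monopoly_lt {l₁ l₂ q₀ p : ℝ} (c₁ c₂ χ : ℝ) (hl : l₁ < l₂)
    (hp : q₀ * l₂ + (1 - q₀) * l₁ < p) :
    vPC c₁ c₂ l₁ l₂ χ q₀ p =
      χ * q₀ * l₂ + (1 - χ * q₀) * l₁ - c₁
        - χ * q₀ * (l₂ - l₁) * (c₂ - c₁) / (p - l₁) :=
  if_pos ((lt_cutoff_iff hl q₀ p).2 hp)

lemma vPC_of_le_monopoly {l₁ l₂ q₀ p : ℝ} (c₁ c₂ χ : ℝ) (hl : l₁ < l₂)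
    (hp : p ≤ q₀ * l₂ + (1 - q₀) * l₁) :
    vPC c₁ c₂ l₁ l₂ χ q₀ p = p - c₂ :=
  if_neg (mt (lt_cutoff_iff hl q₀ p).1 hp.not_gt)

/-- Above the monopoly price, the value is strictly increasing in the price. -/
lemma vPC_lt_of_monopoly_lt {c₁ c₂ l₁ l₂ χ q₀ p p' : ℝ} (hc : c₁ < c₂) (hl : l₁ < l₂)
    (hq : 0 < q₀) (hχ : 0 < χ) (hp : q₀ * l₂ + (1 - q₀) * l₁ < p) (hpp : p < p') :
    vPC c₁ c₂ l₁ l₂ χ q₀ p < vPC c₁ c₂ l₁ l₂ χ q₀ p' := by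
  rw [vPC_of_monopoly_lt c₁ c₂ χ hl hp, vPC_of_monopoly_lt c₁ c₂ χ hl (hp.trans hpp)]
  have hd : 0 < l₂ - l₁ := sub_pos.2 hl
  have hp₁ : 0 < p - l₁ := by linarith [mul_pos hq hd]
  have hk : 0 < χ * q₀ * (l₂ - l₁) * (c₂ - c₁) :=
    mul_pos (mul_pos (mul_pos hχ hq) hd) (sub_pos.2 hc)
  have := div_lt_div_of_pos_left hk hp₁ (sub_lt_sub_right hpp l₁)
  linarith

/-- Up to the monopoly price, the value is strictly increasing in the price. -/
lemma vPC_lt_of_le_monopoly {l₁ l₂ q₀ p p' : ℝ} (c₁ c₂ χ : ℝ) (hl : l₁ < l₂)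
    (hpp : p < p') (hp' : p' ≤ q₀ * l₂ + (1 - q₀) * l₁) :
    vPC c₁ c₂ l₁ l₂ χ q₀ p < vPC c₁ c₂ l₁ l₂ χ q₀ p' := by
  rw [vPC_of_le_monopoly c₁ c₂ χ hl (hpp.le.trans hp'), vPC_of_le_monopoly c₁ c₂ χ hl hp']
  linarith

/-- claim in the public-credibility analysis: on [l₁ − c₁ + c₂, l₂] the
value v^pc_χ(q₀; ·) is strictly dominated at any point above the monopoly price
p₂^M = q₀l₂ + (1 − q₀)l₁ (other than l₂) by its value at l₂, and at any point below p₂^M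
by its value at p₂^M; hence its supremum is the max over the points l₂ and p₂^M (the
latter when it lies in the interval). -/
theorem public_credibility_optimal_price
    (c₁ c₂ l₁ l₂ : ℝ) (hc₁ : 0 ≤ c₁) (hc : c₁ < c₂) (h₁ : c₁ < l₁) (h₂ : c₂ < l₂)
    (hs : l₁ - c₁ < l₂ - c₂)
    (q₀ χ : ℝ) (hq₀ : q₀ ∈ Set.Ioo (0:ℝ) 1) (hχ : χ ∈ Set.Ioo (0:ℝ) 1) :
    (∀ p₂ ∈ Set.Icc (l₁ - c₁ + c₂) l₂,
      (q₀ * l₂ + (1 - q₀) * l₁ < p₂ → p₂ ≠ l₂ →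
        vPC c₁ c₂ l₁ l₂ χ q₀ p₂ < vPC c₁ c₂ l₁ l₂ χ q₀ l₂) ∧
      (p₂ < q₀ * l₂ + (1 - q₀) * l₁ →
        (l₁ - c₁ + c₂ < q₀ * l₂ + (1 - q₀) * l₁ ∧ q₀ * l₂ + (1 - q₀) * l₁ ≤ l₂) ∧
        vPC c₁ c₂ l₁ l₂ χ q₀ p₂ < vPC c₁ c₂ l₁ l₂ χ q₀ (q₀ * l₂ + (1 - q₀) * l₁))) ∧
    sSup {e | ∃ p₂ ∈ Set.Icc (l₁ - c₁ + c₂) l₂, e = vPC c₁ c₂ l₁ l₂ χ q₀ p₂}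
      = if q₀ * l₂ + (1 - q₀) * l₁ ∈ Set.Icc (l₁ - c₁ + c₂) l₂ then
          max (vPC c₁ c₂ l₁ l₂ χ q₀ l₂)
            (vPC c₁ c₂ l₁ l₂ χ q₀ (q₀ * l₂ + (1 - q₀) * l₁))
        else vPC c₁ c₂ l₁ l₂ χ q₀ l₂ := by
  obtain ⟨hq, hq1⟩ := hq₀
  have hl : l₁ < l₂ := by linarith
  have hM : q₀ * l₂ + (1 - q₀) * l₁ < l₂ := by
    linarith [mul_pos (sub_pos.2 hq1) (sub_pos.2 hl)]
  have key : ∀ p₂ ∈ Set.Icc (l₁ - c₁ + c₂) l₂,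
      (q₀ * l₂ + (1 - q₀) * l₁ < p₂ → p₂ ≠ l₂ →
        vPC c₁ c₂ l₁ l₂ χ q₀ p₂ < vPC c₁ c₂ l₁ l₂ χ q₀ l₂) ∧
      (p₂ < q₀ * l₂ + (1 - q₀) * l₁ →
        (l₁ - c₁ + c₂ < q₀ * l₂ + (1 - q₀) * l₁ ∧ q₀ * l₂ + (1 - q₀) * l₁ ≤ l₂) ∧
        vPC c₁ c₂ l₁ l₂ χ q₀ p₂ < vPC c₁ c₂ l₁ l₂ χ q₀ (q₀ * l₂ + (1 - q₀) * l₁)) :=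
    fun p hp =>
      ⟨fun h hne => vPC_lt_of_monopoly_lt hc hl hq hχ.1 h (lt_of_le_of_ne hp.2 hne),
        fun h => ⟨⟨hp.1.trans_lt h, hM.le⟩, vPC_lt_of_le_monopoly c₁ c₂ χ hl h le_rfl⟩⟩
  refine ⟨key, IsGreatest.csSup_eq ?_⟩
  have hl₂ : l₂ ∈ Set.Icc (l₁ - c₁ + c₂) l₂ := ⟨by linarith, le_rfl⟩
  have above : ∀ p ∈ Set.Icc (l₁ - c₁ + c₂) l₂, q₀ * l₂ + (1 - q₀) * l₁ < p →
      vPC c₁ c₂ l₁ l₂ χ q₀ p ≤ vPC c₁ c₂ l₁ l₂ χ q₀ l₂ := by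
    intro p hp h
    rcases eq_or_ne p l₂ with rfl | hne
    · exact le_rfl
    · exact ((key p hp).1 h hne).le
  split_ifs with hmem
  · constructor
    · rcases max_choice (vPC c₁ c₂ l₁ l₂ χ q₀ l₂)
        (vPC c₁ c₂ l₁ l₂ χ q₀ (q₀ * l₂ + (1 - q₀) * l₁)) with h | h
      · exact ⟨l₂, hl₂, h⟩
      · exact ⟨_, hmem, h⟩
    · rintro _ ⟨p, hp, rfl⟩
      rcases lt_trichotomy p (q₀ * l₂ + (1 - q₀) * l₁) with h | h | h
      · exact le_max_of_le_right ((key p hp).2 h).2.le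
      · exact le_max_of_le_right (h ▸ le_rfl)
      · exact le_max_of_le_left (above p hp h)
  · refine ⟨⟨l₂, hl₂, rfl⟩, ?_⟩
    rintro _ ⟨p, hp, rfl⟩
    exact above p hp (lt_of_not_ge fun h => hmem ⟨hp.1.trans h, hM.le⟩)
end

section
/- (Expert's equilibrium value with public credibility.) For all q₀, χ ∈ (0,1): sup{v^pc_χ(q₀; p₂) : p₂ ∈ [l₁ − c₁ + c₂, l₂]} = ev^pc_χ(q₀); moreover the supremum is attained at p₂ = l₂ whenever q₀ ≤ q^pc_χ, and at p₂ = q₀·l₂ + (1 − q₀)·l₁ whenever q₀ ≥ q^pc_χ. -/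
open scoped Classical

lemma qPC_le_iff {c₁ c₂ l₁ l₂ χ q : ℝ} (hc : c₁ < c₂) (hs : l₁ - c₁ < l₂ - c₂)
    (hχ : χ ∈ Set.Ioo (0 : ℝ) 1) :
    qPC c₁ c₂ l₁ l₂ χ ≤ q ↔
      χ * q * (l₂ - c₂) + (1 - χ * q) * (l₁ - c₁) ≤ q * l₂ + (1 - q) * l₁ - c₂ := by
  obtain ⟨hχ₀, hχ₁⟩ := hχ
  have hpos : 0 < (1 - χ) * (l₂ - l₁) + χ * (c₂ - c₁) :=
    add_pos (mul_pos (by linarith) (by linarith)) (mul_pos hχ₀ (by linarith))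
  rw [qPC, div_le_iff₀ hpos]
  constructor <;> intro h <;> linarith

lemma evPC_eq_max {c₁ c₂ l₁ l₂ χ : ℝ} (q : ℝ) (hc : c₁ < c₂) (hs : l₁ - c₁ < l₂ - c₂)
    (hχ : χ ∈ Set.Ioo (0 : ℝ) 1) :
    evPC c₁ c₂ l₁ l₂ χ q =
      max (χ * q * (l₂ - c₂) + (1 - χ * q) * (l₁ - c₁)) (q * l₂ + (1 - q) * l₁ - c₂) := by
  have h := qPC_le_iff (q := q) hc hs hχ
  unfold evPC
  split_ifs with hq
  · exact (max_eq_right (h.1 hq)).symm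
  · exact (max_eq_left (not_le.1 (mt h.2 hq)).le).symm

lemma vPC_top (c₁ c₂ χ : ℝ) {l₁ l₂ q : ℝ} (hl : l₁ < l₂) (hq : q < 1) :
    vPC c₁ c₂ l₁ l₂ χ q l₂ = χ * q * (l₂ - c₂) + (1 - χ * q) * (l₁ - c₁) := by
  have hD : l₂ - l₁ ≠ 0 := (sub_pos.2 hl).ne'
  rw [vPC, div_self hD, if_pos hq]
  field_simp
  ring

lemma vPC_monopoly_price (c₁ c₂ χ q : ℝ) {l₁ l₂ : ℝ} (hl : l₁ < l₂) :
    vPC c₁ c₂ l₁ l₂ χ q (q * l₂ + (1 - q) * l₁) = q * l₂ + (1 - q) * l₁ - c₂ := by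
  have hD : 0 < l₂ - l₁ := sub_pos.2 hl
  rw [vPC, if_neg]
  rw [not_lt, div_le_iff₀ hD]
  linarith

lemma vPC_le_max {c₁ c₂ l₁ l₂ χ q p : ℝ} (hc : c₁ ≤ c₂) (hl : l₁ < l₂) (hχ : 0 ≤ χ)
    (hq : 0 ≤ q) (hp₁ : l₁ < p) (hp₂ : p ≤ l₂) :
    vPC c₁ c₂ l₁ l₂ χ q p ≤
      max (χ * q * (l₂ - c₂) + (1 - χ * q) * (l₁ - c₁)) (q * l₂ + (1 - q) * l₁ - c₂) := by
  have hD : 0 < l₂ - l₁ := sub_pos.2 hl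
  unfold vPC
  split_ifs with h
  · refine le_max_of_le_left ?_
    have key : χ * q * (c₂ - c₁) ≤ χ * q * (l₂ - l₁) * (c₂ - c₁) / (p - l₁) := by
      rw [le_div_iff₀ (sub_pos.2 hp₁), mul_right_comm _ (l₂ - l₁)]
      exact mul_le_mul_of_nonneg_left (by linarith)
        (mul_nonneg (mul_nonneg hχ hq) (sub_nonneg.2 hc))
    linarith
  · refine le_max_of_le_right ?_
    rw [not_lt, div_le_iff₀ hD] at h
    linarith

/-- expert's equilibrium value with public credibility: the supremum of
v^pc_χ(q₀; ·) over [l₁ − c₁ + c₂, l₂] equals ev^pc_χ(q₀); it is attained at p₂ = l₂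
whenever q₀ ≤ q^pc_χ, and at the monopoly price q₀l₂ + (1 − q₀)l₁ whenever q₀ ≥ q^pc_χ. -/
theorem public_credibility_equilibrium_value
    (c₁ c₂ l₁ l₂ : ℝ) (hc₁ : 0 ≤ c₁) (hc : c₁ < c₂) (h₁ : c₁ < l₁) (h₂ : c₂ < l₂)
    (hs : l₁ - c₁ < l₂ - c₂)
    (q₀ χ : ℝ) (hq₀ : q₀ ∈ Set.Ioo (0:ℝ) 1) (hχ : χ ∈ Set.Ioo (0:ℝ) 1) :
    sSup {e | ∃ p₂ ∈ Set.Icc (l₁ - c₁ + c₂) l₂, e = vPC c₁ c₂ l₁ l₂ χ q₀ p₂}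
      = evPC c₁ c₂ l₁ l₂ χ q₀ ∧
    (q₀ ≤ qPC c₁ c₂ l₁ l₂ χ → vPC c₁ c₂ l₁ l₂ χ q₀ l₂ = evPC c₁ c₂ l₁ l₂ χ q₀) ∧
    (qPC c₁ c₂ l₁ l₂ χ ≤ q₀ →
      vPC c₁ c₂ l₁ l₂ χ q₀ (q₀ * l₂ + (1 - q₀) * l₁) = evPC c₁ c₂ l₁ l₂ χ q₀) := by
  have hl : l₁ < l₂ := by linarith
  have htop := vPC_top c₁ c₂ χ hl hq₀.2
  have hmon := vPC_monopoly_price c₁ c₂ χ q₀ hl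
  have hiff := qPC_le_iff (q := q₀) hc hs hχ
  have hev := evPC_eq_max q₀ hc hs hχ
  have hlow (h : q₀ ≤ qPC c₁ c₂ l₁ l₂ χ) :
      vPC c₁ c₂ l₁ l₂ χ q₀ l₂ = evPC c₁ c₂ l₁ l₂ χ q₀ := by
    rw [htop, hev, eq_comm, max_eq_left_iff]
    have hpos : 0 < (1 - χ) * (l₂ - l₁) + χ * (c₂ - c₁) :=
      add_pos (mul_pos (by linarith [hχ.2]) (by linarith)) (mul_pos hχ.1 (by linarith))
    rw [qPC, le_div_iff₀ hpos] at h
    linarith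
  have hhigh (h : qPC c₁ c₂ l₁ l₂ χ ≤ q₀) :
      vPC c₁ c₂ l₁ l₂ χ q₀ (q₀ * l₂ + (1 - q₀) * l₁) = evPC c₁ c₂ l₁ l₂ χ q₀ := by
    rw [hmon, hev, max_eq_right (hiff.1 h)]
  refine ⟨IsGreatest.csSup_eq ⟨?_, ?_⟩, hlow, hhigh⟩
  · rcases le_total q₀ (qPC c₁ c₂ l₁ l₂ χ) with h | h
    · exact ⟨l₂, ⟨by linarith, le_rfl⟩, (hlow h).symm⟩
    · refine ⟨_, ⟨?_, ?_⟩, (hhigh h).symm⟩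
      · have hgain : 0 ≤ χ * q₀ * ((l₂ - c₂) - (l₁ - c₁)) :=
          mul_nonneg (mul_pos hχ.1 hq₀.1).le (by linarith)
        linarith [hiff.1 h]
      · nlinarith [mul_pos (sub_pos.2 hq₀.2) (sub_pos.2 hl)]
  · rintro _ ⟨p, ⟨hp₁, hp₂⟩, rfl⟩
    rw [hev]
    exact vPC_le_max hc.le hl hχ.1.le hq₀.1.le (by linarith) hp₂
end
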